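/- arXiv:2202.09651 — 3 statements merged into one kernel-verified Lean document; each statement's English description precedes it below -/
import Mathlib

section
/- Suppose Assumption 1 holds. Then for all x, y ∈ ℝᵖ, the Hessian of f satisfies ‖∇²f(x) − ∇²f(y)‖ ≤ 3 λ̄ (‖x‖ + ‖y‖) ‖x − y‖ in spectral norm. -/
open scoped RealInnerProductSpace

section

variable {ι : Type*} [Fintype ι] [DecidableEq ι]

lemma toEuclideanCLM_vecMulVec_apply (x y v : EuclideanSpace ℝ ι) :
    Matrix.toEuclideanCLM (𝕜 := ℝ) (Matrix.vecMulVec (x : ι → ℝ) (y : ι → ℝ)) v = ⟪y, v⟫ • x := by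
  ext i
  simp [Matrix.ofLp_toEuclideanCLM, Matrix.vecMulVec_mulVec, PiLp.inner_apply, dotProduct, mul_comm]

lemma Matrix.IsSymm.inner_toEuclideanCLM_comm {A : Matrix ι ι ℝ} (hA : A.IsSymm)
    (u v : EuclideanSpace ℝ ι) :
    ⟪Matrix.toEuclideanCLM (𝕜 := ℝ) A u, v⟫ = ⟪u, Matrix.toEuclideanCLM (𝕜 := ℝ) A v⟫ := by
  have h : star (Matrix.toEuclideanCLM (𝕜 := ℝ) A) = Matrix.toEuclideanCLM (𝕜 := ℝ) A := by
    rw [← map_star, Matrix.star_eq_conjTranspose, Matrix.conjTranspose_eq_transpose_of_trivial, hA]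
  rw [← ContinuousLinearMap.adjoint_inner_right, ← ContinuousLinearMap.star_eq_adjoint, h]

/-- Cauchy–Schwarz for the quartic form whose diagonal is bounded by the upper half of the
quadratic measurement condition. -/
lemma mul_sum_inner_mul_inner_le {E κ : Type*} [NormedAddCommGroup E] [InnerProductSpace ℝ E]
    [Fintype κ] (T : κ → E →L[ℝ] E) {c L : ℝ} (hc : 0 ≤ c) (hL : 0 ≤ L)
    (h : ∀ u v : E, c * ∑ i, ⟪u, T i v⟫ ^ 2 ≤ L * ‖u‖ ^ 2 * ‖v‖ ^ 2) (u v w z : E) :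
    c * ∑ i, ⟪u, T i v⟫ * ⟪w, T i z⟫ ≤ L * (‖u‖ * ‖v‖) * (‖w‖ * ‖z‖) := by
  refine le_of_abs_le (abs_le_of_sq_le_sq ?_ (by positivity))
  calc (c * ∑ i, ⟪u, T i v⟫ * ⟪w, T i z⟫) ^ 2
      = c ^ 2 * (∑ i, ⟪u, T i v⟫ * ⟪w, T i z⟫) ^ 2 := by ring
    _ ≤ c ^ 2 * ((∑ i, ⟪u, T i v⟫ ^ 2) * ∑ i, ⟪w, T i z⟫ ^ 2) := by
        gcongr
        exact Finset.sum_mul_sq_le_sq_mul_sq _ _ _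
    _ = (c * ∑ i, ⟪u, T i v⟫ ^ 2) * (c * ∑ i, ⟪w, T i z⟫ ^ 2) := by ring
    _ ≤ (L * ‖u‖ ^ 2 * ‖v‖ ^ 2) * (L * ‖w‖ ^ 2 * ‖z‖ ^ 2) :=
        mul_le_mul (h u v) (h w z) (by positivity) (by positivity)
    _ = (L * (‖u‖ * ‖v‖) * (‖w‖ * ‖z‖)) ^ 2 := by ring

lemma ContinuousLinearMap.opNorm_le_of_inner_le {E : Type*} [NormedAddCommGroup E]
    [InnerProductSpace ℝ E] (T : E →L[ℝ] E) {C : ℝ} (hC : 0 ≤ C)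
    (h : ∀ u v, ⟪u, T v⟫ ≤ C * ‖u‖ * ‖v‖) : ‖T‖ ≤ C := by
  refine T.opNorm_le_bound hC fun v => ?_
  rcases (norm_nonneg (T v)).eq_or_lt with h0 | h0
  · rw [← h0]
    positivity
  · have := h (T v) v
    rw [real_inner_self_eq_norm_sq] at this
    nlinarith

end

/-- Under Assumption 1, the Hessian of `f` satisfies the Lipschitz-type
spectral norm bound `‖∇²f(x) − ∇²f(y)‖ ≤ 3 λ̄ (‖x‖ + ‖y‖) ‖x − y‖`. -/
theorem stmt_3 {n p : ℕ} (hn : 0 < n) (hp : 0 < p)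
    (A : Fin n → Matrix (Fin p) (Fin p) ℝ) (hA : ∀ i, (A i).IsSymm)
    (b : Fin n → ℝ) (lam lamBar : ℝ) (hlam : 0 < lam) (hlam' : lam ≤ lamBar)
    (hAss : ∀ u v : EuclideanSpace ℝ (Fin p),
      lam * ‖u‖ ^ 2 * ‖v‖ ^ 2 ≤
          (1 / n : ℝ) * ∑ i, ⟪u, (Matrix.toEuclideanCLM (𝕜 := ℝ) (A i)) v⟫ ^ 2 ∧
        (1 / n : ℝ) * ∑ i, ⟪u, (Matrix.toEuclideanCLM (𝕜 := ℝ) (A i)) v⟫ ^ 2 ≤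
          lamBar * ‖u‖ ^ 2 * ‖v‖ ^ 2)
    (H : EuclideanSpace ℝ (Fin p) → Matrix (Fin p) (Fin p) ℝ)
    (hH : ∀ x, H x =
      (2 / n : ℝ) • ∑ i, A i * Matrix.vecMulVec (x : Fin p → ℝ) (x : Fin p → ℝ) * A i +
      (1 / n : ℝ) • ∑ i, (⟪x, (Matrix.toEuclideanCLM (𝕜 := ℝ) (A i)) x⟫ - b i) • A i) :
    ∀ x y : EuclideanSpace ℝ (Fin p),
      ‖Matrix.toEuclideanCLM (𝕜 := ℝ) (H x - H y)‖ ≤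
        3 * lamBar * (‖x‖ + ‖y‖) * ‖x - y‖ := by
  intro x y
  have hL : 0 ≤ lamBar := (hlam.trans_le hlam').le
  set T := fun i => Matrix.toEuclideanCLM (𝕜 := ℝ) (A i) with hT
  have symm : ∀ i u v, ⟪T i u, v⟫ = ⟪u, T i v⟫ := fun i => (hA i).inner_toEuclideanCLM_comm
  have hess : ∀ x u v, ⟪u, Matrix.toEuclideanCLM (𝕜 := ℝ) (H x) v⟫ =
      (1 / n : ℝ) * ∑ i, (2 * (⟪u, T i x⟫ * ⟪v, T i x⟫) + (⟪x, T i x⟫ - b i) * ⟪u, T i v⟫) := by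
    intro x u v
    have rank_one : ∀ i, Matrix.toEuclideanCLM (𝕜 := ℝ)
        (A i * Matrix.vecMulVec (x : Fin p → ℝ) (x : Fin p → ℝ) * A i) v = ⟪v, T i x⟫ • T i x := by
      intro i
      rw [map_mul, map_mul, mul_apply_eq_comp, mul_apply_eq_comp,
        toEuclideanCLM_vecMulVec_apply, map_smul, ← symm, real_inner_comm]
    rw [hH]
    simp only [map_add, map_smul, map_sum, add_apply, smul_apply, sum_apply, rank_one,
      inner_add_right, inner_smul_right, inner_sum, Finset.sum_add_distrib, ← Finset.mul_sum,
      mul_comm (inner ℝ v _)]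
    ring
  have key := mul_sum_inner_mul_inner_le T (c := 1 / n) (by positivity) hL fun u v => (hAss u v).2
  refine ContinuousLinearMap.opNorm_le_of_inner_le _ (by positivity) fun u v => ?_
  have polar : ⟪u, Matrix.toEuclideanCLM (𝕜 := ℝ) (H x - H y) v⟫ =
      (1 / n : ℝ) * ∑ i, ⟪u, T i (x - y)⟫ * ⟪v, T i (x + y)⟫ +
      (1 / n : ℝ) * ∑ i, ⟪u, T i (x + y)⟫ * ⟪v, T i (x - y)⟫ +
      (1 / n : ℝ) * ∑ i, ⟪x - y, T i (x + y)⟫ * ⟪u, T i v⟫ := by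
    rw [map_sub, sub_apply, inner_sub_right, hess, hess, ← mul_sub,
      ← mul_add, ← mul_add, ← Finset.sum_sub_distrib, ← Finset.sum_add_distrib,
      ← Finset.sum_add_distrib]
    congr 1
    refine Finset.sum_congr rfl fun i _ => ?_
    have hxy : ⟪y, T i x⟫ = ⟪x, T i y⟫ := by rw [← symm, real_inner_comm]
    simp only [map_add, map_sub, inner_add_right, inner_sub_right, inner_sub_left, hxy]
    ring
  calc ⟪u, Matrix.toEuclideanCLM (𝕜 := ℝ) (H x - H y) v⟫
      ≤ lamBar * (‖u‖ * ‖x - y‖) * (‖v‖ * ‖x + y‖) + lamBar * (‖u‖ * ‖x + y‖) * (‖v‖ * ‖x - y‖) +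
          lamBar * (‖x - y‖ * ‖x + y‖) * (‖u‖ * ‖v‖) := by
        rw [polar]
        exact add_le_add (add_le_add (key _ _ _ _) (key _ _ _ _)) (key _ _ _ _)
    _ = 3 * lamBar * ‖x + y‖ * ‖x - y‖ * ‖u‖ * ‖v‖ := by ring
    _ ≤ 3 * lamBar * (‖x‖ + ‖y‖) * ‖x - y‖ * ‖u‖ * ‖v‖ := by
        gcongr
        exact norm_add_le x y
end

section
/- Suppose Assumption 1 holds, x* ∈ ℝᵖ, and the measurements are noiseless: b_i = ⟨x*, A_i x*⟩ for every i = 1,…,n. If x̂ ∈ ℝᵖ satisfies f(x̂) ≤ f(x*) (in particular, if x̂ is a global minimizer of f), then x̂ = x* or x̂ = −x*. -/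
open scoped RealInnerProductSpace

/-- A symmetric real matrix acts as a self-adjoint operator on Euclidean space. -/
theorem Matrix.IsSymm.inner_toEuclideanCLM_comm_s7 {ι : Type*} [Fintype ι] [DecidableEq ι]
    {M : Matrix ι ι ℝ} (hM : M.IsSymm) (u v : EuclideanSpace ℝ ι) :
    ⟪u, Matrix.toEuclideanCLM (𝕜 := ℝ) M v⟫ = ⟪v, Matrix.toEuclideanCLM (𝕜 := ℝ) M u⟫ := by
  have hM' : IsSelfAdjoint M := by
    rw [isSelfAdjoint_iff, Matrix.star_eq_conjTranspose, Matrix.conjTranspose_eq_transpose_of_trivial]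
    exact hM
  have h : IsSelfAdjoint (Matrix.toEuclideanCLM (𝕜 := ℝ) M) :=
    hM'.map (Matrix.toEuclideanCLM (𝕜 := ℝ))
  rw [real_inner_comm]
  exact h.isSymmetric v u

/-- Polarization: `⟨x - y, M (x + y)⟩ = ⟨x, M x⟩ - ⟨y, M y⟩` for symmetric `M`. -/
theorem Matrix.IsSymm.inner_sub_toEuclideanCLM_add {ι : Type*} [Fintype ι] [DecidableEq ι]
    {M : Matrix ι ι ℝ} (hM : M.IsSymm) (x y : EuclideanSpace ℝ ι) :
    ⟪x - y, Matrix.toEuclideanCLM (𝕜 := ℝ) M (x + y)⟫ =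
      ⟪x, Matrix.toEuclideanCLM (𝕜 := ℝ) M x⟫ - ⟪y, Matrix.toEuclideanCLM (𝕜 := ℝ) M y⟫ := by
  rw [map_add, inner_sub_left, inner_add_right, inner_add_right,
    hM.inner_toEuclideanCLM_comm_s7 x y]
  ring

/-- Under Assumption 1, in the noiseless case `bᵢ = ⟨x*, Aᵢ x*⟩`, any point
`x̂` with `f(x̂) ≤ f(x*)` (in particular any global minimizer of `f`) satisfies
`x̂ = x*` or `x̂ = −x*`. -/
theorem stmt_7 {n p : ℕ} (hn : 0 < n) (hp : 0 < p)
    (A : Fin n → Matrix (Fin p) (Fin p) ℝ) (hA : ∀ i, (A i).IsSymm)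
    (b : Fin n → ℝ) (lam lamBar : ℝ) (hlam : 0 < lam) (hlam' : lam ≤ lamBar)
    (hAss : ∀ u v : EuclideanSpace ℝ (Fin p),
      lam * ‖u‖ ^ 2 * ‖v‖ ^ 2 ≤
          (1 / n : ℝ) * ∑ i, ⟪u, (Matrix.toEuclideanCLM (𝕜 := ℝ) (A i)) v⟫ ^ 2 ∧
        (1 / n : ℝ) * ∑ i, ⟪u, (Matrix.toEuclideanCLM (𝕜 := ℝ) (A i)) v⟫ ^ 2 ≤
          lamBar * ‖u‖ ^ 2 * ‖v‖ ^ 2)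
    (xs : EuclideanSpace ℝ (Fin p))
    (hb : ∀ i, b i = ⟪xs, (Matrix.toEuclideanCLM (𝕜 := ℝ) (A i)) xs⟫)
    (f : EuclideanSpace ℝ (Fin p) → ℝ)
    (hf : ∀ x, f x = (1 / (4 * n) : ℝ) *
      ∑ i, (⟪x, (Matrix.toEuclideanCLM (𝕜 := ℝ) (A i)) x⟫ - b i) ^ 2)
    (xhat : EuclideanSpace ℝ (Fin p)) (hxhat : f xhat ≤ f xs) :
    xhat = xs ∨ xhat = -xs := by
  have hn' : (0 : ℝ) < n := by exact_mod_cast hn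
  have hfxs : f xs = 0 := by simp [hf, hb]
  rw [hfxs, hf] at hxhat
  have hsum : ∑ i, ⟪xhat - xs, Matrix.toEuclideanCLM (𝕜 := ℝ) (A i) (xhat + xs)⟫ ^ 2 ≤ 0 := by
    simp only [(hA _).inner_sub_toEuclideanCLM_add, ← hb]
    exact nonpos_of_mul_nonpos_right hxhat (by positivity)
  have hle : lam * ‖xhat - xs‖ ^ 2 * ‖xhat + xs‖ ^ 2 ≤ 0 :=
    (hAss _ _).1.trans (mul_nonpos_of_nonneg_of_nonpos (by positivity) hsum)
  have hzero : lam * ‖xhat - xs‖ ^ 2 * ‖xhat + xs‖ ^ 2 = 0 := le_antisymm hle (by positivity)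
  simpa [hlam.ne', sub_eq_zero, add_eq_zero_iff_eq_neg] using hzero
end

section
/- Let x*, x̄ ∈ ℝᵖ, ε ∈ ℝⁿ, and suppose b_i = ⟨x*, A_i x*⟩ + ε_i for every i = 1,…,n. Write x⁻ = x̄ − x* and x⁺ = x̄ + x*. If ∇f(x̄) = 0, then ⟨x⁻, ∇²f(x̄) x⁻⟩ = (1/(2n)) Σ_{i=1}^n [ ⟨x⁻, A_i x⁻⟩² − 3 ⟨x⁻, A_i x⁺⟩² + ⟨x⁻, A_i (2x⁻ + 4x⁺)⟩ ε_i ]. -/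
open scoped RealInnerProductSpace

theorem inner_toEuclideanCLM_comm_of_isSymm {ι : Type*} [Fintype ι] [DecidableEq ι]
    {A : Matrix ι ι ℝ} (hA : A.IsSymm) (u v : EuclideanSpace ℝ ι) :
    ⟪u, (Matrix.toEuclideanCLM (𝕜 := ℝ) A) v⟫ = ⟪v, (Matrix.toEuclideanCLM (𝕜 := ℝ) A) u⟫ := by
  have h : star (Matrix.toEuclideanCLM (𝕜 := ℝ) A) = Matrix.toEuclideanCLM (𝕜 := ℝ) A := by
    rw [← map_star, Matrix.star_eq_conjTranspose, Matrix.conjTranspose_eq_transpose_of_trivial,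
      hA.eq]
  rw [← ContinuousLinearMap.adjoint_inner_left, ← ContinuousLinearMap.star_eq_adjoint, h,
    real_inner_comm]

theorem toEuclideanCLM_vecMulVec_apply_s17 {ι : Type*} [Fintype ι] [DecidableEq ι]
    (u v w : EuclideanSpace ℝ ι) :
    (Matrix.toEuclideanCLM (𝕜 := ℝ) (Matrix.vecMulVec (u : ι → ℝ) (v : ι → ℝ))) w =
      ⟪v, w⟫ • u := by
  ext j
  simp [Matrix.ofLp_toEuclideanCLM, Matrix.vecMulVec_mulVec, PiLp.inner_apply, dotProduct,
    mul_comm]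

theorem inner_toEuclideanCLM_mul_vecMulVec_mul {ι : Type*} [Fintype ι] [DecidableEq ι]
    {A : Matrix ι ι ℝ} (hA : A.IsSymm) (x u : EuclideanSpace ℝ ι) :
    ⟪u, (Matrix.toEuclideanCLM (𝕜 := ℝ)
      (A * Matrix.vecMulVec (x : ι → ℝ) (x : ι → ℝ) * A)) u⟫ =
      ⟪u, (Matrix.toEuclideanCLM (𝕜 := ℝ) A) x⟫ ^ 2 := by
  rw [map_mul, map_mul, mul_apply_eq_comp, mul_apply_eq_comp,
    toEuclideanCLM_vecMulVec_apply_s17, map_smul, inner_smul_right,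
    inner_toEuclideanCLM_comm_of_isSymm hA x u, sq]

/-- With `bᵢ = ⟨x*, Aᵢ x*⟩ + εᵢ`, `x⁻ = x̄ − x*`, `x⁺ = x̄ + x*`, if
`∇f(x̄) = 0` then
`⟨x⁻, ∇²f(x̄) x⁻⟩ = (1/(2n)) ∑ᵢ [⟨x⁻, Aᵢ x⁻⟩² − 3⟨x⁻, Aᵢ x⁺⟩² + ⟨x⁻, Aᵢ(2x⁻+4x⁺)⟩ εᵢ]`. -/
theorem stmt_17 {n p : ℕ} (hn : 0 < n) (hp : 0 < p)
    (A : Fin n → Matrix (Fin p) (Fin p) ℝ) (hA : ∀ i, (A i).IsSymm)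
    (b ε : Fin n → ℝ)
    (xs xb : EuclideanSpace ℝ (Fin p))
    (hb : ∀ i, b i = ⟪xs, (Matrix.toEuclideanCLM (𝕜 := ℝ) (A i)) xs⟫ + ε i)
    (H : EuclideanSpace ℝ (Fin p) → Matrix (Fin p) (Fin p) ℝ)
    (hH : ∀ x, H x =
      (2 / n : ℝ) • ∑ i, A i * Matrix.vecMulVec (x : Fin p → ℝ) (x : Fin p → ℝ) * A i +
      (1 / n : ℝ) • ∑ i, (⟪x, (Matrix.toEuclideanCLM (𝕜 := ℝ) (A i)) x⟫ - b i) • A i)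
    (hgrad : (1 / n : ℝ) •
      ∑ i, (⟪xb, (Matrix.toEuclideanCLM (𝕜 := ℝ) (A i)) xb⟫ - b i) •
        (Matrix.toEuclideanCLM (𝕜 := ℝ) (A i)) xb = (0 : EuclideanSpace ℝ (Fin p))) :
    ⟪xb - xs, (Matrix.toEuclideanCLM (𝕜 := ℝ) (H xb)) (xb - xs)⟫ =
      (1 / (2 * n) : ℝ) * ∑ i,
        (⟪xb - xs, (Matrix.toEuclideanCLM (𝕜 := ℝ) (A i)) (xb - xs)⟫ ^ 2 -
          3 * ⟪xb - xs, (Matrix.toEuclideanCLM (𝕜 := ℝ) (A i)) (xb + xs)⟫ ^ 2 +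
          ⟪xb - xs, (Matrix.toEuclideanCLM (𝕜 := ℝ) (A i))
            ((2 : ℝ) • (xb - xs) + (4 : ℝ) • (xb + xs))⟫ * ε i) := by
  have hn' : (n : ℝ) ≠ 0 := Nat.cast_ne_zero.mpr hn.ne'
  have hstat : ∑ i, (⟪xb, (Matrix.toEuclideanCLM (𝕜 := ℝ) (A i)) xb⟫ - b i) *
      ⟪xb - xs, (Matrix.toEuclideanCLM (𝕜 := ℝ) (A i)) xb⟫ = 0 := by
    have h := (smul_eq_zero.mp hgrad).resolve_left (one_div_ne_zero hn')
    simpa only [inner_sum, inner_smul_right, inner_zero_right] using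
      congrArg (fun v => ⟪xb - xs, v⟫) h
  have hquad : ⟪xb - xs, (Matrix.toEuclideanCLM (𝕜 := ℝ) (H xb)) (xb - xs)⟫ =
      (1 / (2 * n) : ℝ) * ∑ i,
        (4 * ⟪xb - xs, (Matrix.toEuclideanCLM (𝕜 := ℝ) (A i)) xb⟫ ^ 2 +
          2 * ((⟪xb, (Matrix.toEuclideanCLM (𝕜 := ℝ) (A i)) xb⟫ - b i) *
            ⟪xb - xs, (Matrix.toEuclideanCLM (𝕜 := ℝ) (A i)) (xb - xs)⟫)) := by
    rw [hH, map_add, map_smul, map_smul, map_sum, map_sum, add_apply,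
      smul_apply, smul_apply,
      sum_apply, sum_apply, inner_add_right,
      inner_smul_right, inner_smul_right, inner_sum, inner_sum, Finset.sum_add_distrib,
      ← Finset.mul_sum, ← Finset.mul_sum]
    simp only [inner_toEuclideanCLM_mul_vecMulVec_mul (hA _), map_smul,
      smul_apply, inner_smul_right]
    field_simp
    ring
  rw [hquad]
  congr 1
  rw [← sub_zero (∑ i, _), ← mul_zero (8 : ℝ), ← hstat, Finset.mul_sum, ← Finset.sum_sub_distrib]
  refine Finset.sum_congr rfl fun i _ => ?_
  simp only [hb, map_sub, map_add, map_smul, inner_sub_left, inner_sub_right, inner_add_right,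
    inner_smul_right, inner_toEuclideanCLM_comm_of_isSymm (hA i) xs xb]
  ring
end
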